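/- arXiv:2112.15041 — 4 statements merged into one kernel-verified Lean document; each statement's English description precedes it below -/
import Mathlib

section
/- Let p > 5 be a prime and let A be a brace of cardinality p^4 whose additive group (A,+) is isomorphic either to C_{p^2} × C_{p^2} or to C_p × C_{p^3}. Then A is right nilpotent. -/
/-- A (left) brace: an abelian group `(A,+)` and a group `(A,∘)` (written `*`)
on the same underlying set, with `a∘(b+c)+a = a∘b+a∘c`; the identity of `(A,∘)`
coincides with `0`. -/
class Brace (A : Type*) extends AddCommGroup A, Group A where
  mul_add_left : ∀ a b c : A, a * (b + c) + a = a * b + a * c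
  one_eq_zero : (1 : A) = 0

namespace Brace

variable {A : Type*} [Brace A]

/-- The star operation `a ∗ b = a∘b - a - b`. -/
def bstar (a b : A) : A := a * b - a - b

/-- `X ∗ Y`: the additive subgroup generated by `{x∗y : x ∈ X, y ∈ Y}`. -/
def starSpan (A : Type*) [Brace A] (X Y : Set A) : AddSubgroup A :=
  AddSubgroup.closure {z : A | ∃ x ∈ X, ∃ y ∈ Y, z = bstar x y}

/-- `A² = A ∗ A`. -/
def sq (A : Type*) [Brace A] : AddSubgroup A := starSpan A Set.univ Set.univ

/-- `A³ = A ∗ A²`. -/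
def cube (A : Type*) [Brace A] : AddSubgroup A := starSpan A Set.univ (sq A : Set A)

/-- The right series: `rightSeries A 0 = A^(1) = A`, `rightSeries A (n+1) = A^(n+1+1) = A^(n+1) ∗ A`. -/
def rightSeries (A : Type*) [Brace A] : ℕ → AddSubgroup A
  | 0 => ⊤
  | n + 1 => starSpan A (rightSeries A n : Set A) Set.univ

/-- A brace is right nilpotent if `A^(n) = 0` for some `n`. -/
def RightNilpotent (A : Type*) [Brace A] : Prop := ∃ n : ℕ, rightSeries A n = ⊥

/-- `c ∈ Z(A)`: `c∗a = a∗c` for all `a`. -/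
def IsCentral (c : A) : Prop := ∀ a : A, bstar c a = bstar a c

end Brace

namespace Brace

variable {A : Type*} [Brace A]

/-- The map `b ↦ a∘b - a`, as an additive endomorphism. -/
def lambdaMap (a : A) : A →+ A where
  toFun b := a * b - a
  map_zero' := by rw [← one_eq_zero, mul_one, sub_self]; exact one_eq_zero.symm
  map_add' b c := by
    have h := mul_add_left a b c
    rw [eq_sub_of_add_eq h]
    abel

theorem lambdaMap_apply (a b : A) : lambdaMap a b = a * b - a := rfl

theorem mul_eq_add_lambdaMap (a b : A) : a * b = a + lambdaMap a b := by
  rw [lambdaMap_apply]; abel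

theorem bstar_eq_lambdaMap_sub (a b : A) : bstar a b = lambdaMap a b - b := rfl

theorem lambdaMap_mul (a b x : A) : lambdaMap (a * b) x = lambdaMap a (lambdaMap b x) := by
  have h : a * b + lambdaMap (a * b) x = a * b + lambdaMap a (lambdaMap b x) := by
    rw [← mul_eq_add_lambdaMap, mul_assoc, mul_eq_add_lambdaMap b x, mul_eq_add_lambdaMap a,
      map_add, mul_eq_add_lambdaMap a b, add_assoc]
  exact add_left_cancel h

theorem lambdaMap_one (x : A) : lambdaMap (1 : A) x = x := by
  rw [lambdaMap_apply, one_mul, one_eq_zero, sub_zero]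

theorem lambdaMap_inv_apply (a x : A) : lambdaMap a⁻¹ (lambdaMap a x) = x := by
  rw [← lambdaMap_mul, inv_mul_cancel, lambdaMap_one]

theorem lambdaMap_apply_inv (a x : A) : lambdaMap a (lambdaMap a⁻¹ x) = x := by
  rw [← lambdaMap_mul, mul_inv_cancel, lambdaMap_one]

theorem lambdaMap_pow (a : A) (n : ℕ) (x : A) :
    lambdaMap (a ^ n) x = (lambdaMap a)^[n] x := by
  induction n with
  | zero => rw [pow_zero, lambdaMap_one, Function.iterate_zero, id]
  | succ n ih => rw [pow_succ', lambdaMap_mul, ih, Function.iterate_succ_apply']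

theorem mul_lambdaMap_inv (a b : A) : a * lambdaMap a⁻¹ b = a + b := by
  rw [mul_eq_add_lambdaMap, lambdaMap_apply_inv]

/-- The iterates of a unipotent additive map along a chain of length four. -/
theorem iterate_unipotent {B : Type*} [AddCommGroup B] (T : B →+ B) {x x₁ x₂ x₃ : B}
    (h : T x = x + x₁) (h₁ : T x₁ = x₁ + x₂) (h₂ : T x₂ = x₂ + x₃) (h₃ : T x₃ = x₃) (n : ℕ) :
    T^[n] x = x + n • x₁ + n.choose 2 • x₂ + n.choose 3 • x₃ := by
  induction n with
  | zero => simp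
  | succ n ih =>
    rw [Function.iterate_succ_apply', ih]
    simp only [map_add, map_nsmul, h, h₁, h₂, h₃, Nat.choose_succ_succ' n 1,
      Nat.choose_succ_succ' n 2, Nat.choose_one_right]
    module

theorem pow_eq_of_unipotent {a x₁ x₂ x₃ : A}
    (h : lambdaMap a a = a + x₁) (h₁ : lambdaMap a x₁ = x₁ + x₂)
    (h₂ : lambdaMap a x₂ = x₂ + x₃) (h₃ : lambdaMap a x₃ = x₃) (n : ℕ) :
    a ^ n = n • a + n.choose 2 • x₁ + n.choose 3 • x₂ + n.choose 4 • x₃ := by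
  induction n with
  | zero => simp [one_eq_zero]
  | succ n ih =>
    rw [pow_succ', mul_eq_add_lambdaMap, ih]
    simp only [map_add, map_nsmul, h, h₁, h₂, h₃, Nat.choose_succ_succ' n 1,
      Nat.choose_succ_succ' n 2, Nat.choose_succ_succ' n 3, Nat.choose_one_right]
    module

theorem starSpan_le {X Y : Set A} {H : AddSubgroup A}
    (h : ∀ x ∈ X, ∀ y ∈ Y, bstar x y ∈ H) : starSpan A X Y ≤ H := by
  rw [starSpan, AddSubgroup.closure_le]
  rintro _ ⟨x, hx, y, hy, rfl⟩
  exact h x hx y hy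

theorem choose_nsmul_eq_zero {B : Type*} [AddCommGroup B] {p k : ℕ} (hp : p.Prime) (hk : k ≠ 0)
    (hkp : k < p) {x : B} (hx : p • x = 0) : p.choose k • x = 0 := by
  obtain ⟨m, hm⟩ := hp.dvd_choose_self hk hkp
  rw [hm, mul_comm, mul_nsmul', hx, nsmul_zero]

/-- Right nilpotency from a chain `A ⊇ J ⊇ pA ⊇ pJ = Z ⊇ p²A ⊇ 0` of `λ`-invariant subgroups. -/
theorem rightNilpotent_of_chain {p : ℕ} (hp : p.Prime) (hp5 : 5 ≤ p) {J Z : AddSubgroup A}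
    (hJ : ∀ a x : A, lambdaMap a x - x ∈ J)
    (hJp : ∀ a : A, ∀ x ∈ J, ∃ w, lambdaMap a x - x = p • w)
    (hJZ : ∀ x, x ∈ J ↔ p • x ∈ Z)
    (hZ : ∀ a : A, ∀ z ∈ Z, lambdaMap a z = z)
    (hpZ : ∀ z ∈ Z, p • z = 0)
    (hZp : ∀ z ∈ Z, ∃ w, z = p • w)
    (hpp : ∀ x : A, p • p • x ∈ Z)
    (hgen : ∀ x ∈ J, (¬ ∃ w, x = p • w) → ∀ y ∈ J, ∃ (n : ℤ) (w : A), y = n • x + p • w) :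
    RightNilpotent A := by
  have hexp (a x : A) : ∃ x₁ x₂ x₃, lambdaMap a x = x + x₁ ∧ lambdaMap a x₁ = x₁ + x₂ ∧
      lambdaMap a x₂ = x₂ + x₃ ∧ lambdaMap a x₃ = x₃ ∧ p • x₂ = 0 ∧ p • x₃ = 0 ∧ x₁ ∈ J := by
    obtain ⟨w, hw⟩ := hJp a _ (hJ a x)
    have hx₃ : lambdaMap a (p • w) - p • w ∈ Z := by
      rw [map_nsmul, ← nsmul_sub]
      exact (hJZ _).1 (hJ a w)
    refine ⟨lambdaMap a x - x, p • w, lambdaMap a (p • w) - p • w, by abel, ?_, by abel,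
      hZ a _ hx₃, ?_, hpZ _ hx₃, hJ a x⟩
    · rw [← hw]; abel
    · rw [← hw, nsmul_sub, ← map_nsmul, hZ a _ ((hJZ _).1 (hJ a x)), sub_self]
  have hpow (a x : A) : lambdaMap (a ^ p) x = x + p • (lambdaMap a x - x) := by
    obtain ⟨x₁, x₂, x₃, h, h₁, h₂, h₃, hx₂, hx₃, -⟩ := hexp a x
    rw [lambdaMap_pow, iterate_unipotent _ h h₁ h₂ h₃,
      choose_nsmul_eq_zero hp (by omega) (by omega) hx₂,
      choose_nsmul_eq_zero hp (by omega) (by omega) hx₃, h, add_sub_cancel_left, add_zero,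
      add_zero]
  have hpow_self (a : A) : ∃ x₁ ∈ J, lambdaMap a a = a + x₁ ∧ a ^ p = p • a + p.choose 2 • x₁ := by
    obtain ⟨x₁, x₂, x₃, h, h₁, h₂, h₃, hx₂, hx₃, hx₁⟩ := hexp a a
    refine ⟨x₁, hx₁, h, ?_⟩
    rw [pow_eq_of_unipotent h h₁ h₂ h₃,
      choose_nsmul_eq_zero hp (by omega) (by omega) hx₂,
      choose_nsmul_eq_zero hp (by omega) (by omega) hx₃, add_zero, add_zero]
  have hpowJ : ∀ j ∈ J, j ^ p = p • j := by
    intro j hj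
    obtain ⟨x₁, -, h, hx⟩ := hpow_self j
    have hx₁ : p • x₁ = 0 := by
      rw [eq_sub_of_add_eq' h.symm, nsmul_sub, ← map_nsmul, hZ j _ ((hJZ j).1 hj), sub_self]
    rw [hx, choose_nsmul_eq_zero hp (by omega) (by omega) hx₁, add_zero]
  have hlamJ : ∀ j ∈ J, ∀ x, lambdaMap (p • j) x = x + p • (lambdaMap j x - x) := by
    intro j hj x
    rw [← hpowJ j hj, hpow]
  have hlamZ : ∀ z ∈ Z, ∀ x, ∃ j ∈ J, lambdaMap z x = x + p • (lambdaMap j x - x) := by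
    intro z hz x
    obtain ⟨j, rfl⟩ := hZp z hz
    have hj := (hJZ j).2 hz
    exact ⟨j, hj, hlamJ j hj x⟩
  have hlamP (a x : A) : lambdaMap (p • a) x - x ∈ Z := by
    obtain ⟨x₁, hx₁, -, ha⟩ := hpow_self a
    obtain ⟨m, hm⟩ := hp.dvd_choose_self (k := 2) (by omega) (by omega)
    have hz : -(p.choose 2 • x₁) ∈ Z := by
      rw [hm, mul_nsmul]
      exact Z.neg_mem (Z.nsmul_mem ((hJZ _).1 hx₁) m)
    have hpa : p • a = a ^ p * -(p.choose 2 • x₁) := by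
      rw [mul_eq_add_lambdaMap, hZ _ _ hz, ha]; abel
    obtain ⟨j, -, hjx⟩ := hlamZ _ hz x
    rw [hpa, lambdaMap_mul, hpow, hjx]
    have h₁ := (hJZ _).1 (hJ j x)
    have h₂ := (hJZ _).1 (hJ a (x + p • (lambdaMap j x - x)))
    convert Z.add_mem h₁ h₂ using 1
    abel
  have hlamJp : ∀ j ∈ J, ∀ x, ∃ w, lambdaMap j x - x = p • w := by
    intro j hj x
    by_contra hx
    obtain ⟨n, w, hn⟩ := hgen _ (hJ j x) hx (-j) (J.neg_mem hj)
    set e := n • x with he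
    have hje : j * e = e + p • (-w) := by
      have h : lambdaMap j e - e = n • (lambdaMap j x - x) := by
        rw [he, map_zsmul, ← zsmul_sub]
      have h' : n • (lambdaMap j x - x) = -j - p • w := eq_sub_of_add_eq hn.symm
      rw [h'] at h
      rw [mul_eq_add_lambdaMap, eq_add_of_sub_eq h]
      module
    have hconj : j = e * (p • lambdaMap e⁻¹ (-w)) * e⁻¹ := by
      rw [eq_mul_inv_iff_mul_eq, ← map_nsmul, mul_lambdaMap_inv, hje]
    apply hx
    obtain ⟨v, hv⟩ := hZp _ (hlamP (lambdaMap e⁻¹ (-w)) (lambdaMap e⁻¹ x))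
    refine ⟨lambdaMap e v, ?_⟩
    rw [← map_nsmul, ← hv, map_sub, lambdaMap_apply_inv, ← lambdaMap_mul, ← lambdaMap_mul, ← hconj]
  have hpA (x : A) : p • x ∈ J := (hJZ _).2 (hpp x)
  let P : AddSubgroup A := (nsmulAddMonoidHom p : A →+ A).range
  let Q : AddSubgroup A := P.map (nsmulAddMonoidHom p : A →+ A)
  have h₁ : rightSeries A 1 ≤ J := starSpan_le fun a _ x _ => hJ a x
  have h₂ : rightSeries A 2 ≤ P := starSpan_le fun a ha x _ => by
    obtain ⟨w, hw⟩ := hlamJp a (h₁ ha) x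
    exact ⟨w, hw.symm⟩
  have h₃ : rightSeries A 3 ≤ Z := starSpan_le fun a ha x _ => by
    obtain ⟨w, rfl⟩ := h₂ ha
    exact hlamP w x
  have h₄ : rightSeries A 4 ≤ Q := starSpan_le fun a ha x _ => by
    obtain ⟨j, hj, hjx⟩ := hlamZ a (h₃ ha) x
    obtain ⟨w, hw⟩ := hlamJp j hj x
    refine ⟨p • w, ⟨w, rfl⟩, ?_⟩
    rw [bstar_eq_lambdaMap_sub, hjx, hw, add_sub_cancel_left]
    rfl
  have h₅ : rightSeries A 5 ≤ ⊥ := starSpan_le fun a ha x _ => by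
    obtain ⟨_, ⟨w, rfl⟩, rfl⟩ := h₄ ha
    change lambdaMap (p • p • w) x - x = 0
    rw [hlamJ _ (hpA w), hpZ _ (hlamP w x), add_zero, sub_self]
  exact ⟨5, le_bot_iff.1 h₅⟩

theorem exists_eq_zsmul_add {B : Type*} [AddCommGroup B] [Finite B] {p : ℕ} (hp : p.Prime)
    {H K : AddSubgroup B} (hHK : H ≤ K) (hcard : Nat.card K = p * Nat.card H)
    {x y : B} (hx : x ∈ K) (hxH : x ∉ H) (hy : y ∈ K) :
    ∃ n : ℤ, ∃ h ∈ H, y = n • x + h := by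
  have hle : H ⊔ AddSubgroup.zmultiples x ≤ K :=
    sup_le hHK ((AddSubgroup.zmultiples_le).2 hx)
  have hsup : H ⊔ AddSubgroup.zmultiples x = K := by
    obtain ⟨d, hd⟩ := AddSubgroup.card_dvd_of_le
      (le_sup_left : H ≤ H ⊔ AddSubgroup.zmultiples x)
    have hpos : 0 < Nat.card H := Nat.card_pos
    have hdp : d ∣ p := by
      have h := AddSubgroup.card_dvd_of_le hle
      rw [hcard, hd, mul_comm p] at h
      exact Nat.dvd_of_mul_dvd_mul_left hpos h
    rcases (Nat.dvd_prime hp).1 hdp with rfl | rfl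
    · have h := AddSubgroup.eq_of_le_of_card_ge
        (le_sup_left : H ≤ H ⊔ AddSubgroup.zmultiples x) (by rw [hd, mul_one])
      refine absurd ?_ hxH
      rw [h]
      exact AddSubgroup.mem_sup_right (AddSubgroup.mem_zmultiples x)
    · exact AddSubgroup.eq_of_le_of_card_ge hle (by rw [hcard, hd, mul_comm])
  rw [← hsup] at hy
  obtain ⟨h, hh, _, ⟨n, rfl⟩, rfl⟩ := AddSubgroup.mem_sup.1 hy
  exact ⟨n, h, hh, add_comm _ _⟩

theorem nsmul_mem_of_card {B : Type*} [AddCommGroup B] [Finite B] {p : ℕ}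
    {H K : AddSubgroup B} (hHK : H ≤ K) (hcard : Nat.card K = p * Nat.card H)
    {x : B} (hx : x ∈ K) : p • x ∈ H := by
  have h := (AddSubgroup.relIndex_mul_relIndex ⊥ H K bot_le hHK)
  rw [AddSubgroup.relIndex_bot_left, AddSubgroup.relIndex_bot_left, hcard, mul_comm] at h
  have h' : H.relIndex K = p := Nat.eq_of_mul_eq_mul_right Nat.card_pos h
  have := (H.addSubgroupOf K).nsmul_index_mem ⟨x, hx⟩
  rw [← AddSubgroup.relIndex, h'] at this
  exact AddSubgroup.mem_addSubgroupOf.1 this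

/-- An additive map of `p`-power order acts trivially on a section of order `p`. -/
theorem sub_mem_of_iterate {B : Type*} [AddCommGroup B] [Finite B] {p : ℕ} (hp : p.Prime)
    {H K : AddSubgroup B} (hHK : H ≤ K) (hcard : Nat.card K = p * Nat.card H) {T : B →+ B}
    (hH : ∀ x ∈ H, T x ∈ H) (hK : ∀ x ∈ K, T x ∈ K) {k : ℕ} (hT : ∀ x, T^[p ^ k] x = x)
    {x : B} (hx : x ∈ K) : T x - x ∈ H := by
  by_cases hxH : x ∈ H
  · exact H.sub_mem (hH x hxH) hxH
  obtain ⟨c, h, hh, hc⟩ := exists_eq_zsmul_add hp hHK hcard hx hxH (hK x hx)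
  have hiter (n : ℕ) : T^[n] x - c ^ n • x ∈ H := by
    induction n with
    | zero => simp
    | succ n ih =>
      have := H.add_mem (hH _ ih) (H.zsmul_mem hh (c ^ n))
      rw [map_sub, map_zsmul, hc] at this
      rw [Function.iterate_succ_apply']
      convert this using 1
      rw [pow_succ]
      module
  have hmem (m : ℤ) (hm : (p : ℤ) ∣ m) : m • x ∈ H := by
    obtain ⟨m, rfl⟩ := hm
    rw [mul_comm, mul_zsmul, natCast_zsmul]
    exact H.zsmul_mem (nsmul_mem_of_card hHK hcard hx) m
  have hdvd (m : ℤ) (hm : m • x ∈ H) : (p : ℤ) ∣ m := by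
    by_contra hnd
    obtain ⟨u, v, huv⟩ := (Nat.prime_iff_prime_int.1 hp).coprime_iff_not_dvd.2 hnd
    apply hxH
    rw [← one_zsmul x, ← huv, add_zsmul, mul_smul, mul_smul]
    exact H.add_mem (H.zsmul_mem (hmem _ dvd_rfl) u) (H.zsmul_mem hm v)
  have hc1 : (p : ℤ) ∣ c - 1 := by
    have := Fact.mk hp
    have h1 := hiter (p ^ k)
    rw [hT] at h1
    have h2 := hdvd (1 - c ^ p ^ k) (by rwa [sub_smul, one_smul])
    rw [← ZMod.intCast_zmod_eq_zero_iff_dvd] at h2 ⊢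
    push_cast at h2 ⊢
    rw [ZMod.pow_card_pow] at h2
    rw [← neg_eq_zero, neg_sub, h2]
  have := H.add_mem (hmem _ hc1) hh
  rw [hc]
  convert this using 1
  module

/-- The action of `(A,∘)` on `(A,+)` by `λ`. -/
abbrev lambdaAction (A : Type*) [Brace A] (S : AddSubgroup A)
    (hS : ∀ a, ∀ x ∈ S, lambdaMap a x ∈ S) : MulAction A S where
  smul a x := ⟨lambdaMap a x, hS a x x.2⟩
  one_smul x := Subtype.ext (lambdaMap_one x.1)
  mul_smul a b x := Subtype.ext (lambdaMap_mul a b x.1)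

theorem exists_fixed_ne_zero {p n : ℕ} (hp : p.Prime) (hcard : Nat.card A = p ^ n)
    {S : AddSubgroup A} (hS : ∀ a : A, ∀ x ∈ S, lambdaMap a x ∈ S) (hpS : p ∣ Nat.card S) :
    ∃ z ∈ S, z ≠ 0 ∧ ∀ a : A, lambdaMap a z = z := by
  have := Fact.mk hp
  have : Finite A := Nat.finite_of_card_ne_zero (by rw [hcard]; exact (pow_pos hp.pos n).ne')
  let := lambdaAction A S hS
  obtain ⟨z, hz, hz0⟩ := (IsPGroup.of_card hcard).exists_fixed_point_of_prime_dvd_card_of_fixed_point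
    S hpS (a := 0) fun a => Subtype.ext (map_zero (lambdaMap a))
  exact ⟨z, z.2, fun h => hz0 (Subtype.ext h.symm), fun a => congrArg Subtype.val (hz a)⟩

theorem rightNilpotent_of_card {p : ℕ} (hp : p.Prime) (hp5 : 5 ≤ p)
    (hcard : Nat.card A = p ^ 4)
    (hrange : Nat.card (nsmulAddMonoidHom p : A →+ A).range = p ^ 2) : RightNilpotent A := by
  have := Fact.mk hp
  have : Finite A := Nat.finite_of_card_ne_zero (by rw [hcard]; exact (pow_pos hp.pos 4).ne')
  set P : AddSubgroup A := (nsmulAddMonoidHom p : A →+ A).range with hP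
  have hPmem (x : A) : p • x ∈ P := ⟨x, rfl⟩
  have hPinv (a x : A) (hx : x ∈ P) : lambdaMap a x ∈ P := by
    obtain ⟨w, rfl⟩ := hx
    exact ⟨lambdaMap a w, (map_nsmul (lambdaMap a) p w).symm⟩
  obtain ⟨z, hzP, hz0, hzfix, hpz⟩ :
      ∃ z ∈ P, z ≠ 0 ∧ (∀ a : A, lambdaMap a z = z) ∧ p • z = 0 := by
    obtain ⟨z, hzP, hz0, hzfix⟩ := exists_fixed_ne_zero hp hcard hPinv
      (by rw [hrange]; exact dvd_pow_self p two_ne_zero)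
    by_cases hpz : p • z = 0
    · exact ⟨z, hzP, hz0, hzfix, hpz⟩
    · refine ⟨p • z, hPmem z, hpz, fun a => by rw [map_nsmul, hzfix], ?_⟩
      have h2 : Nat.card P • (⟨z, hzP⟩ : P) = 0 := card_nsmul_eq_zero'
      rw [hrange, pow_two, mul_nsmul] at h2
      exact congrArg Subtype.val h2
  set Z := AddSubgroup.zmultiples z with hZdef
  have hZcard : Nat.card Z = p := by
    rw [hZdef, Nat.card_zmultiples, addOrderOf_eq_prime hpz hz0]
  have hZP : Z ≤ P := AddSubgroup.zmultiples_le.2 hzP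
  have hZfix (a x : A) (hx : x ∈ Z) : lambdaMap a x = x := by
    obtain ⟨n, rfl⟩ := hx
    change lambdaMap a (n • z) = n • z
    rw [map_zsmul, hzfix]
  have hPZ : Nat.card P = p * Nat.card Z := by rw [hrange, hZcard, pow_two]
  have hiter (a x : A) : (lambdaMap a)^[p ^ 4] x = x := by
    rw [← lambdaMap_pow, ← hcard, pow_card_eq_one', lambdaMap_one]
  set J := Z.comap (nsmulAddMonoidHom p : A →+ A) with hJdef
  have hJmem (x : A) : x ∈ J ↔ p • x ∈ Z := Iff.rfl
  have hPJ : P ≤ J := fun x hx => nsmul_mem_of_card hZP hPZ hx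
  have hJcard : Nat.card J = p * Nat.card P := by
    have h1 : J.index = p := by
      rw [hJdef, AddSubgroup.index_comap, ← hP]
      have h := AddSubgroup.relIndex_mul_relIndex ⊥ Z P bot_le hZP
      rw [AddSubgroup.relIndex_bot_left, AddSubgroup.relIndex_bot_left, hPZ, mul_comm] at h
      exact Nat.eq_of_mul_eq_mul_right Nat.card_pos h
    have h2 := J.card_mul_index
    rw [h1, hcard] at h2
    rw [hrange]
    exact Nat.eq_of_mul_eq_mul_right hp.pos (h2.trans (by ring))
  have hJinv (a x : A) (hx : x ∈ J) : lambdaMap a x ∈ J := by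
    rw [hJmem] at hx ⊢
    rwa [← map_nsmul, hZfix a _ hx]
  refine rightNilpotent_of_chain hp hp5 (J := J) (Z := Z) ?_ ?_ hJmem hZfix ?_ ?_ ?_ ?_
  · intro a x
    rw [hJmem, nsmul_sub, ← map_nsmul]
    exact sub_mem_of_iterate hp hZP hPZ (fun x hx => by rwa [hZfix a x hx]) (hPinv a) (hiter a)
      (hPmem x)
  · intro a x hx
    obtain ⟨w, hw⟩ := sub_mem_of_iterate hp hPJ hJcard (hPinv a) (hJinv a) (hiter a) hx
    exact ⟨w, hw.symm⟩
  · rintro _ ⟨n, rfl⟩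
    change p • n • z = 0
    rw [smul_comm, hpz, smul_zero]
  · intro x hx
    obtain ⟨w, hw⟩ := hZP hx
    exact ⟨w, hw.symm⟩
  · exact fun x => hPJ (hPmem x)
  · intro x hx hxP y hy
    obtain ⟨n, _, ⟨w, rfl⟩, h⟩ := exists_eq_zsmul_add hp hPJ hJcard hx
      (fun ⟨w, hw⟩ => hxP ⟨w, hw.symm⟩) hy
    exact ⟨n, w, h⟩

end Brace

theorem AddEquiv.card_range_nsmul {B C : Type*} [AddCommGroup B] [AddCommGroup C] (e : B ≃+ C)
    (n : ℕ) : Nat.card (nsmulAddMonoidHom n : B →+ B).range =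
      Nat.card (nsmulAddMonoidHom n : C →+ C).range := by
  refine Nat.card_congr (e.toEquiv.subtypeEquiv fun x => ?_)
  constructor
  · rintro ⟨w, rfl⟩
    exact ⟨e w, (map_nsmul e n w).symm⟩
  · rintro ⟨w, hw⟩
    exact ⟨e.symm w, e.injective ((map_nsmul e n _).trans (by rw [e.apply_symm_apply]; exact hw))⟩

theorem ZMod.card_range_nsmul_prod (m n d : ℕ) [NeZero m] [NeZero n] :
    Nat.card (nsmulAddMonoidHom d : ZMod m × ZMod n →+ ZMod m × ZMod n).range =
      m / m.gcd d * (n / n.gcd d) := by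
  have h : (nsmulAddMonoidHom d : ZMod m × ZMod n →+ ZMod m × ZMod n) =
      (nsmulAddMonoidHom d).prodMap (nsmulAddMonoidHom d) := rfl
  rw [h, AddMonoidHom.range_prodMap, Nat.card_congr (AddSubgroup.prodEquiv _ _).toEquiv,
    Nat.card_prod, IsAddCyclic.card_nsmulAddMonoidHom_range,
    IsAddCyclic.card_nsmulAddMonoidHom_range, Nat.card_zmod, Nat.card_zmod]

/-- a brace of cardinality p^4 (p > 5 prime) with additive group
C_{p^2} × C_{p^2} or C_p × C_{p^3} is right nilpotent. -/
theorem brace_p4_right_nilpotent (p : ℕ) (hp : p.Prime) (hp5 : 5 < p)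
    (A : Type*) [Brace A] (hcard : Nat.card A = p ^ 4)
    (hadd : Nonempty (A ≃+ ZMod (p ^ 2) × ZMod (p ^ 2)) ∨
            Nonempty (A ≃+ ZMod p × ZMod (p ^ 3))) :
    Brace.RightNilpotent A := by
  have : NeZero p := ⟨hp.ne_zero⟩
  refine Brace.rightNilpotent_of_card hp hp5.le hcard ?_
  have hgcd (k : ℕ) (hk : k ≠ 0) : (p ^ k).gcd p = p := Nat.gcd_eq_right (dvd_pow_self p hk)
  have hdiv (k : ℕ) : p ^ (k + 1) / p = p ^ k := by
    rw [pow_succ, Nat.mul_div_cancel _ hp.pos]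
  rcases hadd with ⟨⟨e⟩⟩ | ⟨⟨e⟩⟩
  · rw [e.card_range_nsmul, ZMod.card_range_nsmul_prod, hgcd 2 two_ne_zero, hdiv 1, ← pow_add]
  · rw [e.card_range_nsmul, ZMod.card_range_nsmul_prod, hgcd 3 three_ne_zero, hdiv 2, Nat.gcd_self,
      Nat.div_self hp.pos, one_mul]
end

section
/- Assume Setup (T). Then for every natural number n ≥ 1, P ∗ P^n = binom(n,3) · (P∗(P∗(P∗P))) + binom(n,2) · (P∗(P∗P)) + n · (P∗P), where P^n is the n-th power of P in (A,∘), binom denotes the binomial coefficient, and k·x denotes the k-fold additive multiple of x. -/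
/-- Setup (T) of the paper: `p > 5` prime, `A` a brace of cardinality `p^4` whose additive
group is `C_p × C_{p^3}` (with `m = 2`) or `C_{p^2} × C_{p^2}` (with `m = 1`), whose
multiplicative group is generated by `{P, Q_1, …, Q_i}`, with `P^{p^m}` central and in `A²`,
each `Q_j` of order at most `p^m`, and every `a ∈ A` writable as
`P^k ∘ Q_{σ(1)}^{a_{σ(1)}} ∘ ⋯ ∘ Q_{σ(i)}^{a_{σ(i)}}` for every ordering `σ`. -/
structure SetupT (p m i : ℕ) (A : Type*) [Brace A] (P : A) (Q : Fin i → A) : Prop where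
  hp : p.Prime
  hp5 : 5 < p
  hcard : Nat.card A = p ^ 4
  hadd : (Nonempty (A ≃+ ZMod p × ZMod (p ^ 3)) ∧ m = 2) ∨
         (Nonempty (A ≃+ ZMod (p ^ 2) × ZMod (p ^ 2)) ∧ m = 1)
  hgen : Subgroup.closure ({P} ∪ Set.range Q) = ⊤
  hcentral : Brace.IsCentral (P ^ (p ^ m))
  hsq : P ^ (p ^ m) ∈ Brace.sq A
  hord : ∀ j : Fin i, orderOf (Q j) ≤ p ^ m
  hdecomp : ∀ a : A, ∀ σ : Equiv.Perm (Fin i), ∃ (k : ℤ) (e : Fin i → ℤ),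
      a = P ^ k * (List.ofFn fun t : Fin i => Q (σ t) ^ e (σ t)).prod

namespace Brace

variable {A : Type*} [Brace A]

/-- `b ↦ a ∗ b` as an additive endomorphism. -/
def starHom (a : A) : AddMonoid.End A where
  toFun := bstar a
  map_zero' := by
    have h : a * (0 : A) = a := by rw [← one_eq_zero, mul_one]
    simp [bstar, h]
  map_add' b c := by
    have h : a * (b + c) = a * b + a * c - a := eq_sub_of_add_eq (mul_add_left a b c)
    simp only [bstar, h]
    abel

theorem starHom_apply (a b : A) : starHom a b = bstar a b := rfl

theorem mul_eq_add_add_bstar (a b : A) : a * b = a + b + bstar a b := by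
  simp only [bstar]
  abel

theorem starHom_add_one_pow_apply (a b : A) (n : ℕ) :
    ((starHom a + 1) ^ n) b = a ^ n * b - a ^ n := by
  induction n generalizing b with
  | zero => simp [one_eq_zero]
  | succ n ih =>
    have h₁ : (starHom a + 1) b = a * b - a := by
      change bstar a b + b = _
      simp only [bstar]
      abel
    have h₂ : a ^ n * (a * b - a) + a ^ n * a = a ^ n * (a * b) + a ^ n := by
      rw [← mul_add_left, sub_add_cancel]
    rw [pow_succ (starHom a + 1)]
    change ((starHom a + 1) ^ n) ((starHom a + 1) b) = _
    rw [h₁, ih, pow_succ, mul_assoc]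
    rw [← eq_sub_iff_add_eq] at h₂
    rw [h₂]
    abel

theorem pow_eq_choose_smul (a : A) (h : (starHom a ^ 4) a = 0) (n : ℕ) :
    a ^ n = n • a + n.choose 2 • bstar a a + n.choose 3 • bstar a (bstar a a) +
      n.choose 4 • bstar a (bstar a (bstar a a)) := by
  have h₄ : starHom a (bstar a (bstar a (bstar a a))) = 0 := h
  induction n with
  | zero => simp [one_eq_zero]
  | succ n ih =>
    rw [pow_succ', mul_eq_add_add_bstar, ← starHom_apply a (a ^ n), ih]
    simp only [map_add, map_nsmul, h₄, Nat.choose_succ_succ' n, add_smul]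
    simp only [starHom_apply, Nat.choose_one_right, one_smul, smul_zero]
    abel

end Brace

/-- A unipotent endomorphism of `p`-power order of a ring in which `p` is nilpotent. -/
theorem isNilpotent_of_add_one_pow_prime_pow_eq_one {R : Type*} [Ring R] {p k l : ℕ}
    (hp : p.Prime) (hR : (p : R) ^ l = 0) {d : R} (hd : (d + 1) ^ p ^ k = 1) :
    IsNilpotent d := by
  obtain ⟨r, hr⟩ := (Commute.one_right d).exists_add_pow_prime_pow_eq hp k
  have h : d ^ p ^ k = p * -(d * r) := by
    rw [hd, one_pow, mul_one, add_right_comm, right_eq_add, mul_assoc] at hr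
    rw [mul_neg, eq_neg_iff_add_eq_zero, hr]
  refine ⟨p ^ k * l, ?_⟩
  rw [pow_mul, h, (Nat.cast_commute p (-(d * r))).mul_pow, hR, zero_mul]

/-- A nilpotent endomorphism of a group of order `p ^ l` has nilpotency index at most `l`. -/
theorem AddMonoid.End.pow_eq_zero_of_card_eq_prime_pow {G : Type*} [AddCommGroup G] {p l : ℕ}
    (hp : p.Prime) (hG : Nat.card G = p ^ l) {d : AddMonoid.End G} (hd : IsNilpotent d) :
    d ^ l = 0 := by
  have : Finite G := Nat.finite_of_card_ne_zero (hG ▸ pow_ne_zero _ hp.ne_zero)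
  let R : ℕ → AddSubgroup G := fun j => AddMonoidHom.range (d ^ j : AddMonoid.End G)
  have hmap (j : ℕ) : R (j + 1) = (R j).map d := by
    simp only [R, pow_succ']
    exact AddMonoidHom.range_comp _ _
  have hle (j : ℕ) : R (j + 1) ≤ R j := by
    rintro _ ⟨y, rfl⟩
    exact ⟨d y, by rw [pow_succ]; rfl⟩
  obtain ⟨N, hN⟩ := hd
  have hstab (j : ℕ) (hj : R (j + 1) = R j) : R j = ⊥ := by
    have hc (k : ℕ) : R (j + k) = R j := by
      induction k with
      | zero => rfl
      | succ k ih => rw [← add_assoc, hmap, ih, ← hmap, hj]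
    rw [← hc N, eq_bot_iff]
    rintro _ ⟨y, rfl⟩
    rw [pow_add, hN, mul_zero]
    rfl
  have hcard (j : ℕ) (hj : j ≤ l) : Nat.card (R j) ∣ p ^ (l - j) := by
    induction j with
    | zero => exact hG ▸ AddSubgroup.card_addSubgroup_dvd_card _
    | succ j ih =>
      obtain ⟨i, hi, hci⟩ := (Nat.dvd_prime_pow hp).1
        ((AddSubgroup.card_dvd_of_le (hle j)).trans (ih (by omega)))
      rcases hi.lt_or_eq with hlt | rfl
      · exact hci ▸ pow_dvd_pow p (by omega)
      · have he : R (j + 1) = R j := AddSubgroup.eq_of_le_of_card_ge (hle j)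
          (hci ▸ Nat.le_of_dvd (pow_pos hp.pos _) (ih (by omega)))
        rw [he, hstab j he]
        simp
  have hbot : R l = ⊥ := AddSubgroup.eq_bot_of_card_eq _ (by simpa using hcard l le_rfl)
  ext x
  have hx : (d ^ l) x ∈ R l := ⟨x, rfl⟩
  rw [hbot] at hx
  exact hx

theorem Brace.starHom_pow_eq_zero {A : Type*} [Brace A] {p l : ℕ} (hp : p.Prime)
    (hA : Nat.card A = p ^ l) (a : A) : starHom a ^ l = 0 := by
  refine AddMonoid.End.pow_eq_zero_of_card_eq_prime_pow hp hA
    (isNilpotent_of_add_one_pow_prime_pow_eq_one (k := l) (l := l) hp ?_ ?_)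
  · ext x
    rw [← Nat.cast_pow, ← hA]
    exact card_nsmul_eq_zero'
  · ext x
    rw [starHom_add_one_pow_apply, ← hA, pow_card_eq_one', one_mul, one_eq_zero, sub_zero]
    rfl

/-- under Setup (T),
P ∗ P^n = C(n,3)·(P∗(P∗(P∗P))) + C(n,2)·(P∗(P∗P)) + n·(P∗P) for n ≥ 1. -/
theorem setupT_star_pow_formula (p m i : ℕ) (A : Type*) [Brace A]
    (P : A) (Q : Fin i → A) (h : SetupT p m i A P Q) :
    ∀ n : ℕ, 1 ≤ n →
      Brace.bstar P (P ^ n) =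
        (n.choose 3) • Brace.bstar P (Brace.bstar P (Brace.bstar P P)) +
        (n.choose 2) • Brace.bstar P (Brace.bstar P P) +
        n • Brace.bstar P P := by
  intro n _
  have hP : (Brace.starHom P ^ 4) P = 0 := by
    rw [Brace.starHom_pow_eq_zero h.hp h.hcard]
    rfl
  have h₄ : Brace.starHom P (Brace.bstar P (Brace.bstar P (Brace.bstar P P))) = 0 := hP
  rw [← Brace.starHom_apply P (P ^ n), Brace.pow_eq_choose_smul P hP n]
  simp only [map_add, map_nsmul, h₄, smul_zero, add_zero]
  simp only [Brace.starHom_apply]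
  abel
end

section
/- Assume Setup (T). Then p^m · (P∗P) lies in A³, and P ∗ P^{p^m} = binom(p^m,2) · (P∗(P∗P)) + p^m · (P∗P), where P^{p^m} is the p^m-th power of P in (A,∘). -/
namespace AddMonoid.End

variable {A : Type*} [AddCommGroup A] {p n : ℕ} {d : AddMonoid.End A}

/-- If the `p ^ k`-th power of `d + 1` is the identity of an additive group of order `p ^ n`,
then `d` is nilpotent. -/
theorem isNilpotent_of_add_one_pow_eq_one (hp : p.Prime) (hA : Nat.card A = p ^ n) {k : ℕ}
    (hd : (d + 1) ^ p ^ k = 1) : IsNilpotent d := by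
  obtain ⟨r, hr⟩ := (Commute.one_right d).exists_add_pow_prime_pow_eq hp k
  rw [hd, one_pow] at hr
  have hdr : d ^ p ^ k = (p : AddMonoid.End A) * -(d * 1 * r) := by
    rw [mul_neg, eq_neg_iff_add_eq_zero]
    have : (1 : AddMonoid.End A) = d ^ p ^ k + p * (d * 1 * r) + 1 := by
      rw [mul_assoc] at hr
      convert hr using 1
      noncomm_ring
    simpa using this.symm
  have hpn : (p : AddMonoid.End A) ^ n = 0 := by
    ext x
    rw [← Nat.cast_pow, AddMonoid.End.natCast_apply, ← hA, card_nsmul_eq_zero']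
    rfl
  refine ⟨p ^ k * n, ?_⟩
  rw [pow_mul, hdr, (Nat.cast_commute p _).mul_pow, hpn, zero_mul]

theorem range_pow_antitone : Antitone fun j : ℕ => AddMonoidHom.range (d ^ j : AddMonoid.End A) :=
  antitone_nat_of_succ_le fun j => by
    rintro _ ⟨x, rfl⟩
    exact ⟨d x, by rw [pow_succ]; rfl⟩

/-- Once the ranges of the powers of a nilpotent endomorphism stabilise, they vanish. -/
theorem range_pow_eq_bot_of_succ (hd : IsNilpotent d) {j : ℕ}
    (h : AddMonoidHom.range (d ^ (j + 1) : AddMonoid.End A) =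
      AddMonoidHom.range (d ^ j : AddMonoid.End A)) :
    AddMonoidHom.range (d ^ j : AddMonoid.End A) = ⊥ := by
  have key : ∀ k, AddMonoidHom.range (d ^ j : AddMonoid.End A) ≤
      AddMonoidHom.range (d ^ (j + k) : AddMonoid.End A) := by
    intro k
    induction k with
    | zero => exact le_rfl
    | succ k ih =>
      rw [← h]
      rintro _ ⟨x, rfl⟩
      obtain ⟨y, hy⟩ := ih ⟨x, rfl⟩
      refine ⟨y, ?_⟩
      rw [← add_assoc, pow_succ', pow_succ']
      exact congrArg d hy
  obtain ⟨k, hk⟩ := hd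
  rw [eq_bot_iff]
  refine (key k).trans ?_
  rintro _ ⟨x, rfl⟩
  rw [pow_add, hk, mul_zero]
  exact AddSubgroup.zero_mem _

theorem card_range_pow_dvd (hp : p.Prime) (hA : Nat.card A = p ^ n) (hd : IsNilpotent d) (j : ℕ) :
    Nat.card (AddMonoidHom.range (d ^ j : AddMonoid.End A)) ∣ p ^ (n - j) := by
  have : Finite A := Nat.finite_of_card_ne_zero (hA ▸ pow_ne_zero n hp.ne_zero)
  induction j with
  | zero =>
    rw [tsub_zero, ← hA]
    exact AddSubgroup.card_addSubgroup_dvd_card _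
  | succ j ih =>
    have hle : AddMonoidHom.range (d ^ (j + 1) : AddMonoid.End A) ≤
      AddMonoidHom.range (d ^ j : AddMonoid.End A) := range_pow_antitone j.le_succ
    by_cases h : AddMonoidHom.range (d ^ (j + 1) : AddMonoid.End A) =
        AddMonoidHom.range (d ^ j : AddMonoid.End A)
    · simp [h, range_pow_eq_bot_of_succ hd h]
    · have hdvd := AddSubgroup.card_dvd_of_le hle
      have hne : Nat.card (AddMonoidHom.range (d ^ (j + 1) : AddMonoid.End A)) ≠
          Nat.card (AddMonoidHom.range (d ^ j : AddMonoid.End A)) := fun hc =>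
        h (AddSubgroup.eq_of_le_of_card_ge hle hc.ge)
      obtain ⟨a, ha, hVa⟩ := (Nat.dvd_prime_pow hp).1 ih
      rw [hVa] at hdvd hne
      obtain ⟨b, hb, hVb⟩ := (Nat.dvd_prime_pow hp).1 hdvd
      rw [hVb] at hne ⊢
      have : b ≠ a := fun hba => hne (hba ▸ rfl)
      exact pow_dvd_pow p (by omega)

end AddMonoid.End

namespace Brace

variable {A : Type*} [Brace A]

theorem mul_sub_left (a b c : A) : a * (b - c) = a * b - a * c + a := by
  have := mul_add_left a (b - c) c
  rw [sub_add_cancel] at this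
  rw [sub_add_eq_add_sub, this, add_sub_cancel_right]

/-- The action `λ_a(b) = a∘b - a` of the multiplicative group on the additive group. -/
def lambda : A →* AddMonoid.End A where
  toFun a := AddMonoidHom.mk' (fun b => a * b - a) fun b c => by
    rw [eq_sub_of_add_eq (mul_add_left a b c)]
    abel
  map_one' := by
    ext b
    change 1 * b - 1 = b
    rw [one_mul, one_eq_zero, sub_zero]
  map_mul' a b := by
    ext c
    change a * b * c - a * b = a * (b * c - b) - a
    rw [mul_sub_left, mul_assoc, add_sub_cancel_right]

theorem lambda_apply (a b : A) : lambda a b = a * b - a := rfl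

/-- The additive endomorphism `b ↦ a ∗ b`. -/
def bstarLeft (a : A) : AddMonoid.End A := lambda a - 1

theorem bstarLeft_add_one (a : A) : bstarLeft a + 1 = lambda a := sub_add_cancel _ _

theorem bstar_self_pow (a : A) (n : ℕ) : bstar a (a ^ n) = lambda (a ^ n) a - a := by
  rw [bstar, lambda_apply, ← pow_succ, ← pow_succ', sub_right_comm]

theorem isNilpotent_bstarLeft {p n : ℕ} (hp : p.Prime) (hA : Nat.card A = p ^ n) (a : A) :
    IsNilpotent (bstarLeft a) :=
  AddMonoid.End.isNilpotent_of_add_one_pow_eq_one hp hA (k := n) <| by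
    rw [bstarLeft_add_one, ← map_pow, ← hA, pow_card_eq_one', map_one]

theorem bstar_self_pow_eq_sum (a : A) (n : ℕ) :
    bstar a (a ^ n) = ∑ j ∈ Finset.range n, n.choose (j + 1) • (bstarLeft a ^ (j + 1)) a := by
  rw [bstar_self_pow, map_pow, ← bstarLeft_add_one, (Commute.one_right _).add_pow,
    Finset.sum_range_succ']
  simp only [one_pow, mul_one, pow_zero, Nat.choose_zero_right, Nat.cast_one]
  let ev : AddMonoid.End A →+ A := AddMonoidHom.mk' (fun f => f a) fun _ _ => rfl
  change ev (_ + 1) - ev 1 = _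
  rw [map_add, map_sum, add_sub_cancel_right]
  refine Finset.sum_congr rfl fun j _ => ?_
  rw [← Nat.cast_comm, ← nsmul_eq_mul]
  rfl

theorem bstar_self_prime_pow {p m : ℕ} (hp : p.Prime) (hp3 : 3 < p) (hm : m ≠ 0)
    (hA : Nat.card A = p ^ 4) (a : A) :
    bstar a (a ^ p ^ m) =
      (p ^ m).choose 2 • bstar a (bstar a a) + p ^ m • bstar a a := by
  have hcard := AddMonoid.End.card_range_pow_dvd hp hA (isNilpotent_bstarLeft hp hA a)
  have hkill : ∀ j, p ^ (4 - j) • (bstarLeft a ^ j) a = 0 := fun j => by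
    obtain ⟨c, hc⟩ := hcard j
    have hx := card_nsmul_eq_zero'
      (x := (⟨(bstarLeft a ^ j) a, a, rfl⟩ : AddMonoidHom.range (bstarLeft a ^ j)))
    have hx' := congrArg Subtype.val hx
    rw [hc, mul_comm, mul_nsmul']
    exact (congrArg (c • ·) hx').trans (nsmul_zero c)
  have hle : 3 ≤ p ^ m := hp3.le.trans (Nat.le_self_pow hm p)
  have hdvd : p ∣ (p ^ m).choose 3 :=
    hp.dvd_choose_pow (by norm_num) (by
      have := Nat.le_self_pow hm p
      omega)
  rw [bstar_self_pow_eq_sum, ← Finset.sum_subset (Finset.range_mono hle)]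
  · have h3 : (p ^ m).choose 3 • (bstarLeft a ^ 3) a = 0 := by
      obtain ⟨c, hc⟩ := hdvd
      rw [hc, mul_comm, mul_nsmul']
      have := hkill 3
      rw [show 4 - 3 = 1 from rfl, pow_one] at this
      rw [this, nsmul_zero]
    simp only [Finset.sum_range_succ, Finset.sum_range_zero, zero_add, Nat.reduceAdd, h3, add_zero,
      Nat.choose_one_right, pow_one]
    rw [add_comm]
    rfl
  · intro j _ hj
    have h4 : 4 - (j + 1) = 0 := by
      have := Finset.mem_range.not.1 hj
      omega
    have := hkill (j + 1)
    rw [h4, pow_zero, one_nsmul] at this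
    rw [this, nsmul_zero]

theorem bstar_mem_sq (a b : A) : bstar a b ∈ sq A :=
  AddSubgroup.subset_closure ⟨a, trivial, b, trivial, rfl⟩

theorem bstar_mem_cube (a : A) {b : A} (hb : b ∈ sq A) : bstar a b ∈ cube A :=
  AddSubgroup.subset_closure ⟨a, trivial, b, hb, rfl⟩

end Brace

/-- under Setup (T), p^m·(P∗P) ∈ A³ and
P ∗ P^{p^m} = C(p^m,2)·(P∗(P∗P)) + p^m·(P∗P). -/
theorem setupT_pm_starPP_mem_cube (p m i : ℕ) (A : Type*) [Brace A]
    (P : A) (Q : Fin i → A) (h : SetupT p m i A P Q) :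
    (p ^ m) • Brace.bstar P P ∈ Brace.cube A ∧
    Brace.bstar P (P ^ (p ^ m)) =
      ((p ^ m).choose 2) • Brace.bstar P (Brace.bstar P P) +
      (p ^ m) • Brace.bstar P P := by
  have hm : m ≠ 0 := by rcases h.hadd with ⟨-, rfl⟩ | ⟨-, rfl⟩ <;> norm_num
  have heq := Brace.bstar_self_prime_pow h.hp (by linarith [h.hp5]) hm h.hcard P
  refine ⟨?_, heq⟩
  rw [← sub_eq_iff_eq_add'.2 heq]
  exact sub_mem (Brace.bstar_mem_cube P h.hsq)
    (nsmul_mem (Brace.bstar_mem_cube P (Brace.bstar_mem_sq P P)) _)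
end

section
/- Assume Setup (T). Then for all n ∈ ℤ, p^m · (P∗P^n) = n·p^m · (P∗P), where P^n is the n-th power of P in (A,∘). -/
namespace Brace

variable {A : Type*} [Brace A]

/-- The additive endomorphism `λ_a : b ↦ a∘b - a`. -/
def lam (a : A) : AddMonoid.End A :=
  AddMonoidHom.mk' (fun b => a * b - a) fun b c => by
    have := mul_add_left a b c
    rw [sub_add_sub_comm, ← this]
    abel

theorem lam_apply (a b : A) : lam a b = a * b - a := rfl

theorem lam_one : lam (1 : A) = 1 := by
  ext b
  simp [lam_apply, one_eq_zero]

theorem lam_mul (a b : A) : lam (a * b) = lam a * lam b := by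
  ext c
  have h : lam a (b * c - b) = lam a (b * c) - lam a b := map_sub _ _ _
  change a * b * c - a * b = lam a (b * c - b)
  rw [h, lam_apply, lam_apply, mul_assoc]
  abel

theorem lam_pow (a : A) (n : ℕ) : lam (a ^ n) = lam a ^ n := by
  induction n with
  | zero => simp [lam_one]
  | succ n ih => rw [pow_succ, pow_succ, lam_mul, ih]

theorem bstar_eq (a b : A) : bstar a b = (lam a - 1) b := by
  change a * b - a - b = (a * b - a) - b
  rfl

end Brace

theorem AddSubgroup.map_lt_self_of_pow_eq_zero {A : Type*} [AddCommGroup A]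
    (f : AddMonoid.End A) (B : AddSubgroup A) (hB : B ≠ ⊥) (hle : B.map f ≤ B) (n : ℕ)
    (hn : ∀ b ∈ B, (f ^ n) b = 0) : B.map f < B := by
  refine lt_of_le_of_ne hle fun heq => hB ?_
  have key : ∀ k : ℕ, ∀ b ∈ B, ∃ c ∈ B, (f ^ k) c = b := by
    intro k
    induction k with
    | zero => exact fun b hb => ⟨b, hb, rfl⟩
    | succ k ih =>
      intro b hb
      obtain ⟨c, hc, rfl⟩ := ih b hb
      rw [← heq] at hc
      obtain ⟨d, hd, rfl⟩ := hc
      exact ⟨d, hd, by rw [pow_succ]; rfl⟩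
  rw [eq_bot_iff]
  intro b hb
  obtain ⟨c, hc, rfl⟩ := key n b hb
  exact hn c hc

/-- An endomorphism of an abelian `p`-group that is nilpotent on an invariant subgroup of order
at most `p²` squares to zero there. -/
theorem AddSubgroup.sq_apply_eq_zero_of_card_le {A : Type*} [AddCommGroup A] {p r : ℕ}
    (hp : p.Prime) (hA : Nat.card A = p ^ r) (f : AddMonoid.End A) (B : AddSubgroup A)
    (hcard : Nat.card B ≤ p ^ 2) (hle : B.map f ≤ B) (n : ℕ)
    (hn : ∀ b ∈ B, (f ^ n) b = 0) : ∀ b ∈ B, f (f b) = 0 := by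
  have : Finite A := Nat.finite_of_card_ne_zero (by rw [hA]; exact pow_ne_zero _ hp.ne_zero)
  have pow_card : ∀ C : AddSubgroup A, ∃ k, Nat.card C = p ^ k := by
    intro C
    have hd : Nat.card C ∣ p ^ r := hA ▸ C.card_addSubgroup_dvd_card
    obtain ⟨k, -, hk⟩ := (Nat.dvd_prime_pow hp).1 hd
    exact ⟨k, hk⟩
  have step : ∀ (C : AddSubgroup A) (k : ℕ), C ≤ B → C.map f ≤ C →
      Nat.card C ≤ p ^ (k + 1) → Nat.card (C.map f) ≤ p ^ k := by
    intro C k hCB hC hk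
    by_cases hbot : C = ⊥
    · have hmap : C.map f = ⊥ := by
        subst hbot
        exact AddSubgroup.map_bot _
      rw [hmap, AddSubgroup.card_bot]
      exact Nat.one_le_pow _ _ hp.pos
    · have hlt := map_lt_self_of_pow_eq_zero f C hbot hC n fun b hb => hn b (hCB hb)
      have h1 : Nat.card (C.map f) < Nat.card C :=
        Set.Finite.card_lt_card (Set.toFinite (C : Set A)) hlt
      obtain ⟨j, hj⟩ := pow_card (C.map f)
      rw [hj] at h1 ⊢
      have h2 := (Nat.pow_lt_pow_iff_right hp.one_lt).1 (h1.trans_le hk)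
      exact Nat.pow_le_pow_right hp.pos (Nat.lt_succ_iff.1 h2)
  have h1 := step B 1 le_rfl hle hcard
  have h2 := step (B.map f) 0 hle (AddSubgroup.map_mono hle) h1
  have h3 : (B.map f).map f = ⊥ := AddSubgroup.eq_bot_of_card_le _ (by simpa using h2)
  intro b hb
  have h4 : f (f b) ∈ (B.map f).map f :=
    AddSubgroup.mem_map_of_mem f (AddSubgroup.mem_map_of_mem f hb)
  rwa [h3] at h4

theorem ZMod.exists_lt_prime_nsmul_eq {p : ℕ} (hp : p.Prime) (k : ℕ) (b : ZMod (p ^ (k + 1))) :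
    ∃ s : Fin p, p ^ k • b = (((s : ℕ) * p ^ k : ℕ) : ZMod (p ^ (k + 1))) := by
  have : NeZero (p ^ (k + 1)) := ⟨pow_ne_zero _ hp.ne_zero⟩
  refine ⟨⟨b.val % p, Nat.mod_lt _ hp.pos⟩, ?_⟩
  conv_lhs => rw [← ZMod.natCast_zmod_val b]
  rw [nsmul_eq_mul, ← Nat.cast_mul, ZMod.natCast_eq_natCast_iff, mul_comm (p ^ k)]
  have := (Nat.mod_modEq b.val p).symm.mul_right' (p ^ k)
  rwa [← pow_succ'] at this

theorem AddEquiv.card_range_nsmul_le_sq {A M N : Type*} [AddCommGroup A] [AddCommGroup M]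
    [AddCommGroup N] {p : ℕ} (e : A ≃+ M × N) (q : ℕ) (u : Fin p → M) (v : Fin p → N)
    (hu : ∀ a : M, ∃ s, q • a = u s) (hv : ∀ b : N, ∃ s, q • b = v s) :
    Nat.card (nsmulAddMonoidHom (α := A) q).range ≤ p ^ 2 := by
  have hsub : ((nsmulAddMonoidHom (α := A) q).range : Set A) ⊆
      Set.range fun s : Fin p × Fin p => e.symm (u s.1, v s.2) := by
    rintro _ ⟨a, rfl⟩
    obtain ⟨s, hs⟩ := hu (e a).1
    obtain ⟨t, ht⟩ := hv (e a).2
    refine ⟨(s, t), ?_⟩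
    apply e.injective
    simp [← hs, ← ht, Prod.ext_iff]
  refine (Nat.card_mono (Set.toFinite _) hsub).trans ?_
  refine (Finite.card_range_le _).trans ?_
  simp [pow_two]

namespace SetupT

variable {p m i : ℕ} {A : Type*} [Brace A] {P : A} {Q : Fin i → A}

theorem card_range_nsmul_le (h : SetupT p m i A P Q) :
    Nat.card (nsmulAddMonoidHom (α := A) (p ^ m)).range ≤ p ^ 2 := by
  rcases h.hadd with ⟨⟨e⟩, rfl⟩ | ⟨⟨e⟩, rfl⟩
  · refine AddEquiv.card_range_nsmul_le_sq e _ (fun _ => 0) _ (fun a => ⟨⟨0, h.hp.pos⟩, ?_⟩)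
      (ZMod.exists_lt_prime_nsmul_eq h.hp 2)
    simp [nsmul_eq_mul]
  · exact AddEquiv.card_range_nsmul_le_sq e _ _ _ (ZMod.exists_lt_prime_nsmul_eq h.hp 1)
      (ZMod.exists_lt_prime_nsmul_eq h.hp 1)

theorem nsmul_eq_zero (h : SetupT p m i A P Q) (a : A) : (p ^ (m + 1)) • a = 0 := by
  rcases h.hadd with ⟨⟨e⟩, rfl⟩ | ⟨⟨e⟩, rfl⟩
  · apply e.injective
    have h3 : (p : ZMod (p ^ 3)) ^ 3 = 0 := by exact_mod_cast ZMod.natCast_self (p ^ 3)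
    simp [Prod.ext_iff, nsmul_eq_mul, h3]
  · apply e.injective
    have h2 : (p : ZMod (p ^ 2)) ^ 2 = 0 := by exact_mod_cast ZMod.natCast_self (p ^ 2)
    simp [Prod.ext_iff, nsmul_eq_mul, h2]

theorem lam_sub_one_pow_nsmul (h : SetupT p m i A P Q) (a : A) :
    ((Brace.lam P - 1) ^ p ^ 4) (p ^ m • a) = 0 := by
  have hpow : Brace.lam P ^ p ^ 4 = 1 := by
    rw [← Brace.lam_pow, ← h.hcard, pow_card_eq_one', Brace.lam_one]
  obtain ⟨r, hr⟩ := (Commute.one_right (Brace.lam P - 1)).exists_add_pow_prime_pow_eq h.hp 4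
  rw [sub_add_cancel, hpow, one_pow] at hr
  have hr' : (Brace.lam P - 1) ^ p ^ 4 = -((p : AddMonoid.End A) *
      ((Brace.lam P - 1) * 1 * r)) := by
    rw [eq_neg_iff_add_eq_zero]
    have := sub_eq_zero.2 hr.symm
    rw [← this]
    simp only [mul_assoc]
    abel
  rw [hr', map_nsmul]
  set s := (Brace.lam P - 1) * 1 * r
  change p ^ m • -(((p : ℕ) : AddMonoid.End A) (s a)) = 0
  rw [AddMonoid.End.natCast_apply, smul_neg, ← mul_smul, ← pow_succ, h.nsmul_eq_zero, neg_zero]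

theorem nsmul_bstar_bstar (h : SetupT p m i A P Q) (a : A) :
    p ^ m • Brace.bstar P (Brace.bstar P a) = 0 := by
  have := AddSubgroup.sq_apply_eq_zero_of_card_le h.hp h.hcard (Brace.lam P - 1)
    (nsmulAddMonoidHom (α := A) (p ^ m)).range h.card_range_nsmul_le
    (by
      rintro _ ⟨_, ⟨a, rfl⟩, rfl⟩
      exact ⟨(Brace.lam P - 1) a, (map_nsmul (Brace.lam P - 1) _ _).symm⟩)
    (p ^ 4)
    (by
      rintro _ ⟨a, rfl⟩
      exact h.lam_sub_one_pow_nsmul a)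
    (p ^ m • a) ⟨a, rfl⟩
  rwa [map_nsmul, map_nsmul, ← Brace.bstar_eq, ← Brace.bstar_eq] at this

theorem zsmul_bstar_zpow_add_one (h : SetupT p m i A P Q) (n : ℤ) :
    (p ^ m : ℤ) • Brace.bstar P (P ^ (n + 1)) =
      (p ^ m : ℤ) • Brace.bstar P (P ^ n) + (p ^ m : ℤ) • Brace.bstar P P := by
  have h0 : (p ^ m : ℤ) • Brace.bstar P (Brace.bstar P (P ^ n)) = 0 := by
    have := h.nsmul_bstar_bstar (P ^ n)
    rwa [← natCast_zsmul, Nat.cast_pow] at this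
  have h1 : Brace.bstar P (P ^ (n + 1)) = Brace.bstar P P + Brace.bstar P (P ^ n) +
      Brace.bstar P (Brace.bstar P (P ^ n)) := by
    rw [zpow_add_one, (Commute.zpow_left (Commute.refl P) n).eq, Brace.mul_eq_add_add_bstar,
      Brace.bstar_eq P (P + P ^ n + _), map_add, map_add]
    simp only [← Brace.bstar_eq]
  rw [h1, smul_add, smul_add, h0, add_zero, add_comm]

end SetupT

/-- under Setup (T), p^m·(P∗P^n) = n·p^m·(P∗P) for all n ∈ ℤ. -/
theorem setupT_pm_star_pow (p m i : ℕ) (A : Type*) [Brace A]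
    (P : A) (Q : Fin i → A) (h : SetupT p m i A P Q) :
    ∀ n : ℤ, ((p ^ m : ℤ)) • Brace.bstar P (P ^ n) =
      (n * (p ^ m : ℤ)) • Brace.bstar P P := by
  intro n
  induction n with
  | zero => simp [Brace.bstar_eq, Brace.one_eq_zero]
  | succ n ih => rw [h.zsmul_bstar_zpow_add_one, ih, add_mul, one_mul, add_smul]
  | pred n ih =>
    have := h.zsmul_bstar_zpow_add_one (-(n : ℤ) - 1)
    rw [sub_add_cancel, ih] at this
    rw [sub_mul, one_mul, sub_smul, this, add_sub_cancel_right]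
end
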